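/- arXiv:2007.05941 — 5 statements merged into one kernel-verified Lean document; each statement's English description precedes it below -/
import Mathlib

section
/- Let ε := (5 − √7)/3. Let n be an integer and (a,b,c) ∈ A(n) with c > 0, c ≥ ε·|a| and a² − n > 0. Let k be an integer with |k| ≥ 3, and set (a',b',c') := x(w_k(a,b,c)) = (−a − kc, c, b + 2ka + k²c). Then |a'| > |a| and |c'| > ε·|a'|. -/
/-- The set `A(n) = {(a,b,c) : bc = a^2 - n}`. -/
def Aset (n : ℤ) : Set (ℤ × ℤ × ℤ) := {p | p.2.1 * p.2.2 = p.1 ^ 2 - n}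

/-- The map `x(a,b,c) = (-a, c, b)` on triples. -/
def xMap : ℤ × ℤ × ℤ → ℤ × ℤ × ℤ := fun p => (-p.1, p.2.2, p.2.1)

/-- The map `w_k(a,b,c) = (a + kc, 2ka + b + k^2 c, c)` on triples. -/
def wMap (k : ℤ) : ℤ × ℤ × ℤ → ℤ × ℤ × ℤ :=
  fun p => (p.1 + k * p.2.2, 2 * k * p.1 + p.2.1 + k ^ 2 * p.2.2, p.2.2)

/-- The constant `ε = (5 - √7)/3 ≈ 0.78`. -/
noncomputable def eps : ℝ := (5 - Real.sqrt 7) / 3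

theorem eps_quadratic : 3 * eps ^ 2 = 10 * eps - 6 := by
  have h := Real.sq_sqrt (show (0 : ℝ) ≤ 7 by norm_num)
  unfold eps
  nlinarith

theorem eps_gt : 0.78 < eps := by
  have h : Real.sqrt 7 < 2.66 := by
    rw [Real.sqrt_lt' (by norm_num)]
    norm_num
  unfold eps
  linarith

theorem eps_lt_one : eps < 1 := by
  have h : 2 < Real.sqrt 7 := by
    rw [Real.lt_sqrt (by norm_num)]
    norm_num
  unfold eps
  linarith

theorem abs_lt_add_mul {a c k : ℝ} (hc : 0 < c) (hca : eps * |a| ≤ c) (hk : 3 ≤ k) :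
    |a| < a + k * c := by
  have h₁ : 0.78 * |a| ≤ eps * |a| := mul_le_mul_of_nonneg_right eps_gt.le (abs_nonneg a)
  have h₂ : 3 * c ≤ k * c := mul_le_mul_of_nonneg_right hk hc.le
  linarith [neg_abs_le a, abs_nonneg a]

theorem eps_mul_add_mul_lt {a b c k : ℝ} (hb : 0 < b) (hca : eps * |a| ≤ c) (hk : 3 ≤ k) :
    eps * (a + k * c) < b + 2 * k * a + k ^ 2 * c := by
  have he := eps_gt
  have he₁ := eps_lt_one
  have h₁ : (2 * k - eps) * -|a| ≤ (2 * k - eps) * a :=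
    mul_le_mul_of_nonneg_left (neg_abs_le a) (by linarith)
  have h₂ : k * (k - eps) * (eps * |a|) ≤ k * (k - eps) * c :=
    mul_le_mul_of_nonneg_left hca (mul_nonneg (by linarith) (by linarith))
  have h₃ : 0 ≤ (k - 3) * ((k + 3) * eps - eps ^ 2 - 2) :=
    mul_nonneg (by linarith) (by nlinarith)
  have h₄ : k * (k - eps) * eps - (2 * k - eps) = (k - 3) * ((k + 3) * eps - eps ^ 2 - 2) := by
    linear_combination -eps_quadratic
  have h₅ : 0 ≤ (k * (k - eps) * eps - (2 * k - eps)) * |a| :=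
    mul_nonneg (h₄ ▸ h₃) (abs_nonneg a)
  linarith

theorem abs_lt_and_eps_mul_lt {a b c k : ℝ} (hb : 0 < b) (hc : 0 < c) (hca : eps * |a| ≤ c)
    (hk : 3 ≤ |k|) :
    |a| < |-a - k * c| ∧ eps * |-a - k * c| < |b + 2 * k * a + k ^ 2 * c| := by
  wlog hk₀ : 0 ≤ k generalizing a k
  · have := this (a := -a) (k := -k) (by rwa [abs_neg]) (by rwa [abs_neg]) (by linarith)
    rw [abs_neg, show - -a - -k * c = -(-a - k * c) by ring, abs_neg,
      show b + 2 * -k * -a + (-k) ^ 2 * c = b + 2 * k * a + k ^ 2 * c by ring] at this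
    exact this
  rw [abs_of_nonneg hk₀] at hk
  have h := abs_lt_add_mul hc hca hk
  rw [show -a - k * c = -(a + k * c) by ring, abs_neg,
    abs_of_pos ((abs_nonneg a).trans_lt h)]
  exact ⟨h, (eps_mul_add_mul_lt hb hca hk).trans_le (le_abs_self _)⟩

theorem stmt1 (n a b c k : ℤ) (h : b * c = a ^ 2 - n) (hc : 0 < c)
    (hca : (c : ℝ) ≥ eps * |(a : ℝ)|) (hn : 0 < a ^ 2 - n) (hk : 3 ≤ |k|) :
    |(-a - k * c)| > |a| ∧
      ((|b + 2 * k * a + k ^ 2 * c| : ℤ) : ℝ) > eps * ((|(-a - k * c)| : ℤ) : ℝ) := by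
  have hb : 0 < b := pos_of_mul_pos_left (h ▸ hn) hc.le
  have key := abs_lt_and_eps_mul_lt (a := a) (b := b) (c := c) (k := k)
    (by exact_mod_cast hb) (by exact_mod_cast hc) hca (by exact_mod_cast hk)
  refine ⟨by exact_mod_cast key.1, ?_⟩
  push_cast
  exact key.2
end

section
/- Let n be a square-free integer (in particular n ≠ 0). Then the set B(n) := {(a,b,c) ∈ ℤ³ : bc = a² − n, |a| ≤ |b|, |a| ≤ |c|} is finite. -/
/-- The set `B(n) = {(a,b,c) ∈ A(n) : |a| ≤ |b|, |a| ≤ |c|}`. -/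
def Bset (n : ℤ) : Set (ℤ × ℤ × ℤ) :=
  {p ∈ Aset n | |p.1| ≤ |p.2.1| ∧ |p.1| ≤ |p.2.2|}

theorem abs_fst_le_of_mem_Bset {n a b c : ℤ} (hn : n ≠ 0) (h : (a, b, c) ∈ Bset n) :
    |a| ≤ |n| := by
  obtain ⟨h, hb, hc⟩ := h
  change b * c = a ^ 2 - n at h
  dsimp only at hb hc
  by_contra! hlt
  have ha : 0 ≤ |a| := abs_nonneg a
  have hsq : |a| ^ 2 = a ^ 2 := sq_abs a
  have hn1 : 1 ≤ |n| := Int.one_le_abs hn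
  have hle : n ≤ |n| := le_abs_self n
  have hge : -n ≤ |n| := neg_le_abs n
  have hprod : |b| * |c| = |a| ^ 2 - n := by
    rw [← abs_mul, h, hsq, abs_of_nonneg]
    nlinarith
  rcases hb.eq_or_lt with hb' | hb'
  · rcases hc.eq_or_lt with hc' | hc'
    · rw [← hb', ← hc'] at hprod
      exact hn (by linarith)
    · nlinarith
  · nlinarith

theorem snd_ne_zero_of_mem_Bset {n a b c : ℤ} (hn : n ≠ 0) (h : (a, b, c) ∈ Bset n) :
    b ≠ 0 ∧ c ≠ 0 := by
  obtain ⟨h, hb, hc⟩ := h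
  change b * c = a ^ 2 - n at h
  have key : |a| ≤ 0 → b * c = 0 → False := fun ha hbc => by
    obtain rfl : a = 0 := abs_nonpos_iff.mp ha
    exact hn (by linarith)
  constructor <;> rintro rfl
  · exact key (by simpa using hb) (zero_mul c)
  · exact key (by simpa using hc) (mul_zero b)

/-- The set `B(n)` is finite for every nonzero `n`. -/
theorem Bset_finite {n : ℤ} (hn : n ≠ 0) : (Bset n).Finite := by
  let I : Set ℤ := Set.Icc (-(n ^ 2 + |n|)) (n ^ 2 + |n|)
  have hI : I.Finite := Set.finite_Icc _ _
  refine (hI.prod (hI.prod hI)).subset ?_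
  rintro ⟨a, b, c⟩ h
  have ha := abs_fst_le_of_mem_Bset hn h
  obtain ⟨hb, hc⟩ := snd_ne_zero_of_mem_Bset hn h
  have hprod : |b| * |c| ≤ n ^ 2 + |n| := by
    have h' : b * c = a ^ 2 - n := h.1
    rw [← abs_mul, h']
    have hsq : a ^ 2 ≤ n ^ 2 := sq_le_sq.mpr ha
    exact (abs_sub _ _).trans (by rw [abs_sq]; linarith)
  have hb1 := Int.one_le_abs hb
  have hc1 := Int.one_le_abs hc
  simp only [I, Set.mem_prod, Set.mem_Icc, ← abs_le]
  exact ⟨by nlinarith, by nlinarith, by nlinarith⟩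

theorem stmt2 (n : ℤ) (hn : Squarefree n) : (Bset n).Finite := by
  exact Bset_finite hn.ne_zero
end

section
/- Let n be a square-free integer and λ ≥ 1 an integer. The action on A(n) of the subgroup of permutations of A(n) generated by x and w_λ has finitely many orbits if and only if λ = 1 or λ = 2. -/
/-- `A(n)` as a type. -/
abbrev AT (n : ℤ) : Type := {p : ℤ × ℤ × ℤ // p.2.1 * p.2.2 = p.1 ^ 2 - n}

/-- The map `x(a,b,c) = (-a, c, b)` as a permutation of `A(n)`. -/
def xPerm (n : ℤ) : Equiv.Perm (AT n) where
  toFun := fun ⟨(a, b, c), h⟩ => ⟨(-a, c, b), by dsimp at h ⊢; linear_combination h⟩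
  invFun := fun ⟨(a, b, c), h⟩ => ⟨(-a, c, b), by dsimp at h ⊢; linear_combination h⟩
  left_inv := fun ⟨(a, b, c), h⟩ => by simp
  right_inv := fun ⟨(a, b, c), h⟩ => by simp

/-- The map `w_k(a,b,c) = (a + kc, 2ka + b + k^2 c, c)` as a permutation of `A(n)`. -/
def wPerm (n k : ℤ) : Equiv.Perm (AT n) where
  toFun := fun ⟨(a, b, c), h⟩ =>
    ⟨(a + k * c, 2 * k * a + b + k ^ 2 * c, c), by dsimp at h ⊢; linear_combination h⟩
  invFun := fun ⟨(a, b, c), h⟩ =>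
    ⟨(a - k * c, -(2 * k) * a + b + k ^ 2 * c, c), by dsimp at h ⊢; linear_combination h⟩
  left_inv := fun ⟨(a, b, c), h⟩ => by
    apply Subtype.ext; dsimp; exact Prod.ext (by ring) (Prod.ext (by ring) rfl)
  right_inv := fun ⟨(a, b, c), h⟩ => by
    apply Subtype.ext; dsimp; exact Prod.ext (by ring) (Prod.ext (by ring) rfl)

/-- The subgroup of permutations of `A(n)` generated by `x` and `w_λ`. -/
def Hgrp (n lam : ℤ) : Subgroup (Equiv.Perm (AT n)) :=
  Subgroup.closure {xPerm n, wPerm n lam}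

/-! ### Powers of the generators -/

theorem xPerm_val (n : ℤ) (p : AT n) :
    (xPerm n p).1 = (-p.1.1, p.1.2.2, p.1.2.1) := rfl

theorem wPerm_val (n k : ℤ) (p : AT n) :
    (wPerm n k p).1 =
      (p.1.1 + k * p.1.2.2, 2 * k * p.1.1 + p.1.2.1 + k ^ 2 * p.1.2.2, p.1.2.2) := rfl

theorem xPerm_xPerm (n : ℤ) (p : AT n) : xPerm n (xPerm n p) = p := by
  apply Subtype.ext
  simp [xPerm_val]

theorem wPerm_zero (n : ℤ) : wPerm n 0 = 1 := by
  ext1 p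
  apply Subtype.ext
  simp [wPerm_val]

theorem wPerm_wPerm (n k l : ℤ) (p : AT n) : wPerm n k (wPerm n l p) = wPerm n (k + l) p := by
  apply Subtype.ext
  simp only [wPerm_val]
  exact Prod.ext (by ring) (Prod.ext (by ring) rfl)

/-- The one-parameter group `k ↦ w_k` of permutations of `A(n)`. -/
def wHom (n : ℤ) : Multiplicative ℤ →* Equiv.Perm (AT n) where
  toFun k := wPerm n k.toAdd
  map_one' := wPerm_zero n
  map_mul' k l := by
    ext1 p
    exact (wPerm_wPerm n k.toAdd l.toAdd p).symm

theorem wPerm_zpow (n k : ℤ) (j : ℤ) : wPerm n k ^ j = wPerm n (j * k) := by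
  have h := map_zpow (wHom n) (Multiplicative.ofAdd k) j
  rw [← ofAdd_zsmul, smul_eq_mul] at h
  exact h.symm

theorem xPerm_mem (n lam : ℤ) : xPerm n ∈ Hgrp n lam :=
  Subgroup.subset_closure (by simp)

theorem wPerm_mul_mem (n lam j : ℤ) : wPerm n (j * lam) ∈ Hgrp n lam := by
  rw [← wPerm_zpow]
  exact Subgroup.zpow_mem _ (Subgroup.subset_closure (by simp)) j

/-! ### Finitely many orbits for `λ = 1, 2` -/

theorem exists_abs_add_mul_le (a c : ℤ) (hc : c ≠ 0) : ∃ k : ℤ, |a + k * 2 * c| ≤ |c| := by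
  have h0 := Int.emod_nonneg a (b := 2 * c) (by omega)
  have h1 := Int.emod_lt_abs a (b := 2 * c) (by omega)
  have h2 := Int.emod_add_mul_ediv a (2 * c)
  rw [abs_mul, abs_two] at h1
  set q := a / (2 * c)
  set r := a % (2 * c)
  by_cases hr : r ≤ |c|
  · refine ⟨-q, ?_⟩
    rw [show a + -q * 2 * c = r by linear_combination -h2, abs_of_nonneg h0]
    exact hr
  · rcases abs_cases c with ⟨hc', _⟩ | ⟨hc', _⟩
    · refine ⟨-q - 1, ?_⟩
      rw [show a + (-q - 1) * 2 * c = r - 2 * c by linear_combination -h2, abs_le]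
      omega
    · refine ⟨-q + 1, ?_⟩
      rw [show a + (-q + 1) * 2 * c = r + 2 * c by linear_combination -h2, abs_le]
      omega

/-- The size bound satisfied by the representatives of the orbits of `H(2)`. -/
def reducedBound (n : ℤ) : ℤ := n ^ 2 + 4 * |n|

theorem reduced_bounded {n a b c : ℤ} (hn0 : n ≠ 0) (h : b * c = a ^ 2 - n) (hc : c ≠ 0)
    (hac : |a| ≤ |c|) (hcb : |c| ≤ |b|) :
    |a| ≤ reducedBound n ∧ |b| ≤ reducedBound n ∧ |c| ≤ reducedBound n := by
  have hc1 : 1 ≤ |c| := Int.one_le_abs hc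
  have hbc : |b| * |c| = |a ^ 2 - n| := by rw [← abs_mul, h]
  have ha2 : |a| ^ 2 = a ^ 2 := sq_abs a
  have hn2 : |n| ^ 2 = n ^ 2 := sq_abs n
  have ha0 := abs_nonneg a
  have hcn : |c| ≤ |n| := by
    rcases le_or_gt (a ^ 2 - n) 0 with hs | hs
    · rw [abs_of_nonpos hs] at hbc
      have := le_abs_self n
      nlinarith
    · rw [abs_of_pos hs] at hbc
      have hn := neg_le_abs n
      have hm : |c| * |c| ≤ |b| * |c| := mul_le_mul_of_nonneg_right hcb (by omega)
      rcases eq_or_lt_of_le hac with he | hlt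
      · rw [← ha2, he] at hbc
        have hd : |c| ∣ n := ⟨|c| - |b|, by linear_combination hbc⟩
        exact Int.le_of_dvd (abs_pos.2 hn0) ((dvd_abs _ _).2 hd)
      · nlinarith
  have hb : |b| ≤ |a ^ 2 - n| := by nlinarith [abs_nonneg b]
  have hb' : |a ^ 2 - n| ≤ a ^ 2 + |n| := by
    rw [abs_le]
    have := neg_le_abs n
    have := le_abs_self n
    constructor <;> nlinarith
  unfold reducedBound
  refine ⟨?_, ?_, ?_⟩ <;> nlinarith

theorem exists_reduced {n : ℤ} (hn : n ≠ 0) (p : AT n) :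
    ∃ g ∈ Hgrp n 2, |(g p).1.1| ≤ reducedBound n ∧ |(g p).1.2.1| ≤ reducedBound n ∧
      |(g p).1.2.2| ≤ reducedBound n := by
  induction hm : p.1.2.2.natAbs using Nat.strong_induction_on generalizing p with
  | _ m ih =>
  obtain ⟨⟨a, b, c⟩, h⟩ := p
  dsimp only at h hm
  rcases eq_or_ne c 0 with rfl | hc
  · have ha : a ≠ 0 := by
      rintro rfl
      apply hn
      linarith
    refine ⟨wPerm n (-(b / (4 * a)) * 2), wPerm_mul_mem _ _ _, ?_⟩
    have h0 := Int.emod_nonneg b (b := 4 * a) (by omega)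
    have h1 := Int.emod_lt_abs b (b := 4 * a) (by omega)
    have h2 := Int.emod_add_mul_ediv b (4 * a)
    have hb : 2 * (-(b / (4 * a)) * 2) * a + b = b % (4 * a) := by linear_combination -h2
    have han : |a| ^ 2 = n := by rw [sq_abs]; linarith
    have ha1 : 1 ≤ |a| := Int.one_le_abs ha
    have hn0 := le_abs_self n
    rw [abs_mul, show |(4 : ℤ)| = 4 from rfl] at h1
    simp only [wPerm_val, mul_zero, add_zero, abs_zero, hb, abs_of_nonneg h0, reducedBound]
    refine ⟨?_, ?_, ?_⟩ <;> nlinarith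
  · obtain ⟨k, hk⟩ := exists_abs_add_mul_le a c hc
    have hw := wPerm_mul_mem n 2 k
    set q := wPerm n (k * 2) ⟨(a, b, c), h⟩ with hq
    have hq1 : q.1.1 = a + k * 2 * c := rfl
    have hq3 : q.1.2.2 = c := rfl
    rcases le_or_gt |c| |q.1.2.1| with hcb | hcb
    · exact ⟨_, hw, reduced_bounded hn q.2 (by rwa [hq3]) (by rwa [hq1, hq3]) (by rwa [hq3])⟩
    · have hlt : (xPerm n q).1.2.2.natAbs < m := by
        rw [← hm]
        exact Int.ofNat_lt.1 (by rwa [Int.natCast_natAbs, Int.natCast_natAbs])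
      obtain ⟨g, hg, hgb⟩ := ih _ hlt (xPerm n q) rfl
      exact ⟨g * xPerm n * wPerm n (k * 2), mul_mem (mul_mem hg (xPerm_mem _ _)) hw, hgb⟩

theorem Hgrp_two_le_one (n : ℤ) : Hgrp n 2 ≤ Hgrp n 1 := by
  rw [Hgrp, Subgroup.closure_le]
  rintro _ (rfl | rfl)
  · exact xPerm_mem n 1
  · exact wPerm_mul_mem n 1 2

theorem finite_orbits {n : ℤ} (hn : n ≠ 0) (H : Subgroup (Equiv.Perm (AT n)))
    (hH : Hgrp n 2 ≤ H) : Finite (Quotient (MulAction.orbitRel ↥H (AT n))) := by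
  let I := Set.Icc (-reducedBound n) (reducedBound n)
  have hfin : {p : AT n | p.1 ∈ I ×ˢ I ×ˢ I}.Finite :=
    Set.Finite.preimage Subtype.val_injective.injOn
      ((Set.finite_Icc _ _).prod ((Set.finite_Icc _ _).prod (Set.finite_Icc _ _)))
  have := hfin.to_subtype
  refine Finite.of_surjective
    (fun p : {p : AT n | p.1 ∈ I ×ˢ I ×ˢ I} => (Quotient.mk _ p.1 : Quotient _)) ?_
  rintro ⟨p⟩
  obtain ⟨g, hg, h1, h2, h3⟩ := exists_reduced hn p
  refine ⟨⟨g p, abs_le.1 h1, abs_le.1 h2, abs_le.1 h3⟩, Quotient.sound ?_⟩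
  exact ⟨⟨g, hH hg⟩, rfl⟩

/-! ### Infinitely many orbits for `λ ≥ 3` -/

/-- The points reached from `p` by reduced words in `x` and the powers of `w_λ`; the flag records
whether the outermost letter may be a power of `w_λ` (`true`) or `x` (`false`). -/
inductive ReducedWord (n lam : ℤ) (p : AT n) : Bool → AT n → Prop
  | base (i : Bool) : ReducedWord n lam p i p
  | x {q : AT n} : ReducedWord n lam p true q → ReducedWord n lam p false (xPerm n q)
  | w {k : ℤ} {q : AT n} : k ≠ 0 → ReducedWord n lam p false q →
      ReducedWord n lam p true (wPerm n (k * lam) q)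

theorem ReducedWord.exists_xPerm {n lam : ℤ} {p q : AT n} {i : Bool}
    (h : ReducedWord n lam p i q) : ∃ j, ReducedWord n lam p j (xPerm n q) := by
  cases h with
  | base => exact ⟨_, .x (.base _)⟩
  | x h => exact ⟨_, by rwa [xPerm_xPerm]⟩
  | w hk h => exact ⟨_, .x (.w hk h)⟩

theorem ReducedWord.exists_wPerm {n lam : ℤ} {p q : AT n} {i : Bool}
    (h : ReducedWord n lam p i q) (k : ℤ) :
    ∃ j, ReducedWord n lam p j (wPerm n (k * lam) q) := by
  have key : ∀ (l : ℤ) {q : AT n}, ReducedWord n lam p false q →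
      ∃ j, ReducedWord n lam p j (wPerm n (l * lam) q) := by
    intro l q hq
    rcases eq_or_ne l 0 with rfl | hl
    · exact ⟨_, by simpa [wPerm_zero] using hq⟩
    · exact ⟨_, .w hl hq⟩
  cases h with
  | base => exact key k (.base _)
  | x h => exact key k (.x h)
  | w hk h => rw [wPerm_wPerm, ← add_mul]; exact key _ h

theorem exists_reducedWord {n lam : ℤ} (p : AT n) {g : Equiv.Perm (AT n)}
    (hg : g ∈ Hgrp n lam) : ∃ i, ReducedWord n lam p i (g p) := by
  induction hg using Subgroup.closure_induction_left with
  | one => exact ⟨true, .base _⟩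
  | mul_left s hs g _ ih =>
    obtain ⟨i, hi⟩ := ih
    rcases hs with rfl | rfl
    · exact hi.exists_xPerm
    · simpa using hi.exists_wPerm 1
  | inv_mul_cancel s hs g _ ih =>
    obtain ⟨i, hi⟩ := ih
    rcases hs with rfl | rfl
    · exact hi.exists_xPerm
    · have := hi.exists_wPerm (-1)
      rwa [← wPerm_zpow, zpow_neg_one] at this

/-- Triples with large positive `b` and `c`. -/
def IsLarge {n : ℤ} (p : AT n) : Prop := |n| < p.1.2.1 ∧ |n| < p.1.2.2

/-- The region corresponding to the fundamental domain of `H(λ)`. -/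
def InDomain {n : ℤ} (lam : ℤ) (p : AT n) : Prop :=
  IsLarge p ∧ p.1.2.2 < p.1.2.1 ∧ |2 * p.1.1| < lam * p.1.2.2

/-- The region corresponding to the inside of the unit circle. -/
def InDisc {n : ℤ} (p : AT n) : Prop := IsLarge p ∧ p.1.2.1 < p.1.2.2

/-- The region corresponding to the outside of the strip of width `λ`. -/
def OffStrip {n : ℤ} (lam : ℤ) (p : AT n) : Prop :=
  IsLarge p ∧ p.1.2.2 < p.1.2.1 ∧ lam * p.1.2.2 < |2 * p.1.1|

theorem abs_two_mul_le {n a b c : ℤ} (h : b * c = a ^ 2 - n) (hb : |n| < b) (hc : |n| < c) :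
    |2 * a| ≤ b + c + 1 := by
  have hn := le_abs_self n
  have hn' := abs_nonneg n
  apply abs_le_of_sq_le_sq _ (by omega)
  nlinarith [sq_nonneg (b - c)]

theorem translate_bounds {lam K a b c : ℤ} (hlam : 3 ≤ lam) (hK : lam ≤ K) (hc : 0 < c)
    (hb : 0 < b) (ha : -(lam * c) < 2 * a) (hcb : c < b ∨ -(2 * c) ≤ 2 * a) :
    c < 2 * K * a + b + K ^ 2 * c ∧ lam * c < 2 * (a + K * c) := by
  have h1 : lam * c ≤ K * c := mul_le_mul_of_nonneg_right hK hc.le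
  refine ⟨?_, by linarith⟩
  have h2 : 2 * K * a + b + K ^ 2 * c = b + K * (2 * a + K * c) := by ring
  rw [h2]
  rcases hcb with hcb | hcb
  · have : 0 ≤ K * (2 * a + K * c) := mul_nonneg (by omega) (by linarith)
    linarith
  · have h3 : c ≤ 2 * a + K * c := by nlinarith
    nlinarith

theorem offStrip_wPerm {n lam k : ℤ} (hlam : 3 ≤ lam) (hk : k ≠ 0) {p : AT n}
    (hp : InDomain lam p ∨ InDisc p) : OffStrip lam (wPerm n (k * lam) p) := by
  obtain ⟨⟨a, b, c⟩, h⟩ := p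
  simp only [OffStrip, IsLarge, InDomain, InDisc, wPerm_val] at *
  have hn := abs_nonneg n
  have hL : |n| < b ∧ |n| < c := by tauto
  have hab : |2 * a| ≤ b + c + 1 := abs_two_mul_le h hL.1 hL.2
  have ha : |2 * a| < lam * c ∧ (c < b ∨ |2 * a| ≤ 2 * c) := by
    rcases hp with hp | hp
    · exact ⟨hp.2.2, .inl hp.2.1⟩
    · have : |2 * a| ≤ 2 * c := by omega
      exact ⟨by nlinarith, .inr this⟩
  rw [abs_lt, abs_le] at ha
  rcases lt_or_gt_of_ne hk with hk | hk
  · obtain ⟨h1, h2⟩ := translate_bounds (K := -(k * lam)) (a := -a) (b := b) (c := c) hlam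
      (by nlinarith) (by omega) (by omega) (by linarith) (by omega)
    rw [show 2 * -(k * lam) * -a + b + (-(k * lam)) ^ 2 * c
      = 2 * (k * lam) * a + b + (k * lam) ^ 2 * c by ring] at h1
    exact ⟨⟨by omega, hL.2⟩, h1, lt_abs.2 (.inr (by linarith))⟩
  · obtain ⟨h1, h2⟩ := translate_bounds (K := k * lam) (a := a) (b := b) (c := c) hlam
      (by nlinarith) (by omega) (by omega) (by linarith) (by omega)
    exact ⟨⟨by omega, hL.2⟩, h1, lt_abs.2 (.inl h2)⟩

theorem inDisc_xPerm {n lam : ℤ} {p : AT n} (hp : InDomain lam p ∨ OffStrip lam p) :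
    InDisc (xPerm n p) := by
  simp only [OffStrip, InDomain, InDisc, IsLarge, xPerm_val] at *
  tauto

theorem ReducedWord.region {n lam : ℤ} (hlam : 3 ≤ lam) {p q : AT n} (hp : InDomain lam p)
    {i : Bool} (h : ReducedWord n lam p i q) :
    q = p ∨ cond i (OffStrip lam q) (InDisc q) := by
  induction h with
  | base => exact .inl rfl
  | x _ ih =>
    rcases ih with rfl | ih
    · exact .inr (inDisc_xPerm (.inl hp))
    · exact .inr (inDisc_xPerm (.inr ih))
  | w hk _ ih =>
    rcases ih with rfl | ih
    · exact .inr (offStrip_wPerm hlam hk (.inl hp))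
    · exact .inr (offStrip_wPerm hlam hk (.inr ih))

theorem eq_of_inDomain {n lam : ℤ} (hlam : 3 ≤ lam) {p : AT n} {g : Equiv.Perm (AT n)}
    (hg : g ∈ Hgrp n lam) (hp : InDomain lam p) (hgp : InDomain lam (g p)) : g p = p := by
  obtain ⟨i, hi⟩ := exists_reducedWord p hg
  rcases hi.region hlam hp with h | h
  · exact h
  · cases i
    · exact absurd h.2 hgp.2.1.not_gt
    · exact absurd h.2.2 hgp.2.2.not_gt

/-- A family of triples whose roots approach `4 / 3`. -/
def domainFamily (n t : ℤ) : AT n :=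
  ⟨((1 + 3 * t) * (1 + 4 * t) - 12 * n, (1 + 4 * t) ^ 2 - 16 * n, (1 + 3 * t) ^ 2 - 9 * n), by
    dsimp only; ring⟩

theorem inDomain_domainFamily {n lam t : ℤ} (hlam : 3 ≤ lam) (ht : 9 * |n| + 1 ≤ t) :
    InDomain lam (domainFamily n t) := by
  have h1 := le_abs_self n
  have h2 := neg_le_abs n
  have h3 := abs_nonneg n
  have ht2 : t ≤ t ^ 2 := by nlinarith
  have hc : 0 < (1 + 3 * t) ^ 2 - 9 * n := by nlinarith
  simp only [InDomain, IsLarge, domainFamily]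
  refine ⟨⟨by nlinarith, by nlinarith⟩, by nlinarith, ?_⟩
  refine lt_of_lt_of_le ?_ (mul_le_mul_of_nonneg_right hlam hc.le)
  rw [abs_lt]
  constructor <;> nlinarith

theorem infinite_orbits {n lam : ℤ} (hlam : 3 ≤ lam) :
    Infinite (Quotient (MulAction.orbitRel ↥(Hgrp n lam) (AT n))) := by
  refine Infinite.of_injective
    (fun s : ℕ => (Quotient.mk _ (domainFamily n (9 * |n| + 1 + s)) : Quotient _)) ?_
  intro s t hst
  obtain ⟨⟨g, hg⟩, hgt⟩ := Quotient.exact hst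
  change g _ = _ at hgt
  have hdom (s : ℕ) : InDomain lam (domainFamily n (9 * |n| + 1 + s)) :=
    inDomain_domainFamily hlam (by omega)
  have heq := eq_of_inDomain hlam hg (hdom t) (hgt ▸ hdom s)
  rw [hgt] at heq
  have h3 : (1 + 3 * (9 * |n| + 1 + (s : ℤ))) ^ 2 - 9 * n
      = (1 + 3 * (9 * |n| + 1 + (t : ℤ))) ^ 2 - 9 * n := congrArg (fun p => p.1.2.2) heq
  have h4 := (sq_eq_sq₀ (by positivity) (by positivity)).1 (sub_left_inj.1 h3)
  omega

theorem stmt5 (n lam : ℤ) (hsf : Squarefree n) (hlam : 1 ≤ lam) :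
    Finite (Quotient (MulAction.orbitRel ↥(Hgrp n lam) (AT n))) ↔ lam = 1 ∨ lam = 2 := by
  constructor
  · intro hfin
    by_contra hne
    have := infinite_orbits (n := n) (lam := lam) (by omega)
    exact not_finite (Quotient (MulAction.orbitRel ↥(Hgrp n lam) (AT n)))
  · rintro (rfl | rfl)
    · exact finite_orbits hsf.ne_zero _ (Hgrp_two_le_one n)
    · exact finite_orbits hsf.ne_zero _ le_rfl
end

section
/- Let n be a square-free integer and λ ≥ 3 an integer. Then the action on A(n) of the subgroup of permutations of A(n) generated by x and w_λ has infinitely many orbits. -/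
/-- The triples obtained from `(a₀, b₀, c₀)` by alternately applying powers of `w_λ` and `x`, where
`x` is only applied to triples `(a, b, c)` with `|c| + |n| ≤ |a|`. -/
inductive Reachable (n lam a₀ b₀ c₀ : ℤ) : ℤ → ℤ → ℤ → Prop
  | base (a b k : ℤ) (ha : a = a₀ + k * lam * c₀)
      (hb : b = 2 * (k * lam) * a₀ + b₀ + (k * lam) ^ 2 * c₀) :
      Reachable n lam a₀ b₀ c₀ a b c₀
  | step (a' b' k a b c : ℤ) (h : Reachable n lam a₀ b₀ c₀ a b c) (hbc : b * c = a ^ 2 - n)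
      (hout : |c| + |n| ≤ |a|) (ha : a' = -a + k * lam * b)
      (hb : b' = 2 * (k * lam) * (-a) + c + (k * lam) ^ 2 * b) :
      Reachable n lam a₀ b₀ c₀ a' b' b

/-- If `|c| + |n| ≤ |a|`, then applying `x` to `(a, b, c)` reverses the domination. -/
lemma abs_add_le_of_out {n a b c : ℤ} (hc : 0 < |c|) (hbc : b * c = a ^ 2 - n)
    (hout : |c| + |n| ≤ |a|) : |a| + |n| ≤ |b| := by
  have h1 : |b| * |c| = |a ^ 2 - n| := by rw [← abs_mul, hbc]
  have h2 : |a| ^ 2 - |n| ≤ |a ^ 2 - n| := by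
    have := abs_sub_abs_le_abs_sub (a ^ 2) n
    rwa [abs_pow] at this
  have h3 : |n| ≤ |n| ^ 2 := by
    rcases (abs_nonneg n).eq_or_lt with h | h
    · simp [← h]
    · nlinarith
  have h4 : (|a| + |n|) * |c| ≤ (|a| + |n|) * (|a| - |n|) :=
    mul_le_mul_of_nonneg_left (by linarith) (by positivity)
  exact le_of_mul_le_mul_right (by nlinarith) hc

namespace Reachable

variable {n lam a₀ b₀ c₀ a b c : ℤ}

lemma abs_le (hc₀ : 0 < |c₀|) (h : Reachable n lam a₀ b₀ c₀ a b c) : |c₀| ≤ |c| := by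
  induction h with
  | base => exact le_rfl
  | step a' b' k a b c h hbc hout ha hb ih =>
    have := abs_add_le_of_out (by omega) hbc hout
    have := abs_nonneg n
    omega

lemma shift (h : Reachable n lam a₀ b₀ c₀ a b c) (k : ℤ) :
    Reachable n lam a₀ b₀ c₀ (a + k * lam * c) (2 * (k * lam) * a + b + (k * lam) ^ 2 * c) c := by
  cases h with
  | base _ _ j ha hb =>
    exact base _ _ (j + k) (by rw [ha]; ring) (by rw [ha, hb]; ring)
  | step _ _ j a b c h hbc hout ha hb =>
    exact step _ _ (j + k) a _ c h hbc hout (by rw [ha]; ring) (by rw [ha, hb]; ring)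

lemma flip (hlam : 3 ≤ lam) (hc₀ : 0 < |c₀|)
    (hgap : ∀ k : ℤ, |c₀| + |n| ≤ |a₀ + k * lam * c₀|)
    (h : Reachable n lam a₀ b₀ c₀ a b c) (hbc : b * c = a ^ 2 - n) :
    Reachable n lam a₀ b₀ c₀ (-a) c b := by
  have key := h
  cases h with
  | base _ _ j ha hb =>
    exact step _ _ 0 a b _ key hbc (ha ▸ hgap j) (by ring) (by ring)
  | step _ _ j a₁ _ c₁ h hbc₁ hout ha hb =>
    rcases eq_or_ne j 0 with rfl | hj
    · convert h using 1
      · rw [ha]; ring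
      · rw [hb]; ring
    · refine step _ _ 0 a b c key hbc ?_ (by ring) (by ring)
      have hin := abs_add_le_of_out (hc₀.trans_le (h.abs_le hc₀)) hbc₁ hout
      have hk : 3 ≤ |j * lam| := by
        rw [abs_mul, abs_of_pos (by omega : 0 < lam)]
        have := Int.one_le_abs hj
        nlinarith
      have hmul : 3 * |c| ≤ |j * lam * c| := by
        rw [abs_mul]
        exact mul_le_mul_of_nonneg_right hk (abs_nonneg c)
      have htri : |j * lam * c| - |a₁| ≤ |a| := by
        rw [ha, ← abs_neg a₁]
        have := abs_sub_abs_le_abs_sub (j * lam * c) (-(-a₁))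
        rw [abs_neg (-a₁)] at this
        rwa [sub_neg_eq_add, add_comm (j * lam * c)] at this
      have := abs_nonneg n
      have := abs_nonneg a₁
      linarith

/-- Reachability is invariant under the group generated by `x` and `w_λ`. -/
lemma iff_of_mem_Hgrp (hlam : 3 ≤ lam) (hc₀ : 0 < |c₀|)
    (hgap : ∀ k : ℤ, |c₀| + |n| ≤ |a₀ + k * lam * c₀|) {g : Equiv.Perm (AT n)}
    (hg : g ∈ Hgrp n lam) (v : AT n) :
    Reachable n lam a₀ b₀ c₀ v.1.1 v.1.2.1 v.1.2.2 ↔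
      Reachable n lam a₀ b₀ c₀ (g v).1.1 (g v).1.2.1 (g v).1.2.2 := by
  induction hg using Subgroup.closure_induction generalizing v with
  | mem g hg =>
    obtain ⟨⟨a, b, c⟩, hv⟩ := v
    rcases hg with rfl | rfl
    · refine ⟨fun h ↦ h.flip hlam hc₀ hgap hv, fun h ↦ ?_⟩
      have := h.flip hlam hc₀ hgap (xPerm n ⟨(a, b, c), hv⟩).2
      simpa [xPerm] using this
    · refine ⟨fun h ↦ ?_, fun h ↦ ?_⟩
      · have := h.shift 1
        simpa [wPerm] using this
      · have := h.shift (-1)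
        simp only [wPerm, Equiv.coe_fn_mk] at this
        convert this using 1 <;> ring
  | one => rfl
  | mul g h _ _ ihg ihh => exact (ihh v).trans (ihg (h v))
  | inv g _ ih => simpa using (ih (g⁻¹ v)).symm

end Reachable

/-- A triple of `A(n)` equivalent to `(0, -n, 1)` under `SL₂(ℤ)`, with `a / c` close to `3 / 2`. -/
def gapTriple (n t : ℤ) : AT n :=
  ⟨(6 - n * (2 * t + 1) * (3 * t + 2), 9 - n * (3 * t + 2) ^ 2, 4 - n * (2 * t + 1) ^ 2),
    by dsimp; ring⟩

lemma abs_gapTriple_lower {n t : ℤ} :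
    |n| * (2 * t + 1) ^ 2 - 4 ≤ |4 - n * (2 * t + 1) ^ 2| := by
  have := abs_sub_abs_le_abs_sub (n * (2 * t + 1) ^ 2) 4
  rw [abs_mul, abs_of_nonneg (sq_nonneg (2 * t + 1)), abs_sub_comm _ (4 : ℤ)] at this
  simpa using this

lemma gapTriple_gap {n lam t : ℤ} (hn : n ≠ 0) (hlam : 3 ≤ lam) (ht : 2 ≤ t) (k : ℤ) :
    |(gapTriple n t).1.2.2| + |n| ≤
      |(gapTriple n t).1.1 + k * lam * (gapTriple n t).1.2.2| := by
  simp only [gapTriple]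
  have hlow := abs_gapTriple_lower (n := n) (t := t)
  set c := 4 - n * (2 * t + 1) ^ 2 with hc
  set a := 6 - n * (2 * t + 1) * (3 * t + 2) with ha
  have hn1 := Int.one_le_abs hn
  have hk : 3 ≤ |3 + 2 * (k * lam)| := by
    rcases le_or_gt 0 k with h | h
    · rw [abs_of_nonneg (by positivity)]
      nlinarith
    · rw [abs_of_nonpos (by nlinarith)]
      nlinarith
  have hmul : 3 * |c| ≤ |(3 + 2 * (k * lam)) * c| := by
    rw [abs_mul]
    exact mul_le_mul_of_nonneg_right hk (abs_nonneg c)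
  have htri := abs_sub_abs_le_abs_sub ((3 + 2 * (k * lam)) * c) (n * (2 * t + 1))
  have heq : (3 + 2 * (k * lam)) * c - n * (2 * t + 1) = 2 * (a + k * lam * c) := by
    rw [hc, ha]; ring
  rw [heq, abs_mul 2, abs_mul n, abs_of_nonneg (by omega : 0 ≤ 2 * t + 1), abs_two] at htri
  have hbound : |n| * (2 * t + 1) + 2 * |n| ≤ |n| * (2 * t + 1) ^ 2 - 4 := by
    nlinarith [mul_le_mul hn1 (show 4 ≤ (2 * t + 1) ^ 2 - (2 * t + 1) - 2 by nlinarith)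
      (by norm_num) (by positivity)]
  linarith

lemma gapTriple_abs_pos {n t : ℤ} (hn : n ≠ 0) (ht : 2 ≤ t) :
    0 < |(gapTriple n t).1.2.2| := by
  have hlow := abs_gapTriple_lower (n := n) (t := t)
  have := Int.one_le_abs hn
  simp only [gapTriple]
  nlinarith

lemma gapTriple_abs_lt {n s t : ℤ} (hn : n ≠ 0) (hs : 2 ≤ s) (hst : s < t) :
    |(gapTriple n s).1.2.2| < |(gapTriple n t).1.2.2| := by
  simp only [gapTriple]
  have hsq : (2 * s + 1) ^ 2 < (2 * t + 1) ^ 2 := by nlinarith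
  have h5 : 4 ≤ (2 * s + 1) ^ 2 := by nlinarith
  rcases hn.lt_or_gt with h | h
  · rw [abs_of_pos (by nlinarith), abs_of_pos (by nlinarith)]
    nlinarith
  · rw [abs_of_nonpos (by nlinarith), abs_of_nonpos (by nlinarith)]
    nlinarith

lemma gapTriple_abs_le_of_orbit {n lam s t : ℤ} (hn : n ≠ 0) (hlam : 3 ≤ lam) (ht : 2 ≤ t)
    (h : gapTriple n s ∈ MulAction.orbit (Hgrp n lam) (gapTriple n t)) :
    |(gapTriple n t).1.2.2| ≤ |(gapTriple n s).1.2.2| := by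
  obtain ⟨⟨g, hg⟩, hgs⟩ := h
  have hpos := gapTriple_abs_pos hn ht
  have hreach := (Reachable.iff_of_mem_Hgrp (b₀ := (gapTriple n t).1.2.1) hlam hpos
    (gapTriple_gap hn hlam ht) hg (gapTriple n t)).1 (.base _ _ 0 (by ring) (by ring))
  have hgs' : g (gapTriple n t) = gapTriple n s := hgs
  rw [hgs'] at hreach
  exact hreach.abs_le hpos

theorem stmt6 (n lam : ℤ) (hsf : Squarefree n) (hlam : 3 ≤ lam) :
    Infinite (Quotient (MulAction.orbitRel ↥(Hgrp n lam) (AT n))) := by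
  have hn : n ≠ 0 := hsf.ne_zero
  refine Infinite.of_injective
    (fun t : ℕ ↦ Quotient.mk (MulAction.orbitRel (Hgrp n lam) (AT n)) (gapTriple n (t + 2))) ?_
  refine Function.Injective.of_lt_imp_ne fun s t hst heq ↦ ?_
  have horb : gapTriple n (s + 2) ∈ MulAction.orbit (Hgrp n lam) (gapTriple n (t + 2)) :=
    MulAction.orbitRel_apply.1 (Quotient.exact heq)
  exact (gapTriple_abs_lt hn (by omega) (by omega)).not_ge
    (gapTriple_abs_le_of_orbit hn hlam (by omega) horb)
end

section
/- Let ε := (5 − √7)/3, let n be an integer and λ ≥ 3 an integer. Let (a,b,c) ∈ A(n) with a > 0, a² − n > 0, b > ε·a and c > ε·a. Then for every element g of the subgroup of permutations of A(n) generated by x and w_λ, the first coordinate a'' of g(a,b,c) satisfies |a''| ≥ a. -/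
theorem xMap_xMap (p : ℤ × ℤ × ℤ) : xMap (xMap p) = p := by
  simp [xMap]

theorem wMap_zero (p : ℤ × ℤ × ℤ) : wMap 0 p = p := by
  simp [wMap]

theorem wMap_wMap (k l : ℤ) (p : ℤ × ℤ × ℤ) : wMap k (wMap l p) = wMap (k + l) p := by
  refine Prod.ext ?_ (Prod.ext ?_ rfl) <;> dsimp [wMap] <;> ring

theorem coe_xPerm (n : ℤ) (v : AT n) : (xPerm n v).1 = xMap v.1 := rfl

theorem coe_wPerm (n k : ℤ) (v : AT n) : (wPerm n k v).1 = wMap k v.1 := rfl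

/-- The triples reached from `p` or `xMap p` by alternating nonzero powers of `wMap lam` with
`xMap`, ending with `xMap`. -/
inductive AlternatingReach (lam : ℤ) (p : ℤ × ℤ × ℤ) : ℤ × ℤ × ℤ → Prop
  | base : AlternatingReach lam p p
  | flip : AlternatingReach lam p (xMap p)
  | step {u : ℤ × ℤ × ℤ} {k : ℤ} (hu : AlternatingReach lam p u) (hk : k ≠ 0) :
      AlternatingReach lam p (xMap (wMap (lam * k) u))

/-- The triples `wMap (lam * k) u` with `u` reached from `p` by an alternating word. -/
def wordOrbit (lam : ℤ) (p : ℤ × ℤ × ℤ) : Set (ℤ × ℤ × ℤ) :=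
  {v | ∃ u k, AlternatingReach lam p u ∧ v = wMap (lam * k) u}

theorem AlternatingReach.mem_wordOrbit {lam : ℤ} {p u : ℤ × ℤ × ℤ}
    (hu : AlternatingReach lam p u) : u ∈ wordOrbit lam p :=
  ⟨u, 0, hu, by rw [mul_zero, wMap_zero]⟩

theorem xMap_mem_wordOrbit {lam : ℤ} {p v : ℤ × ℤ × ℤ} (hv : v ∈ wordOrbit lam p) :
    xMap v ∈ wordOrbit lam p := by
  obtain ⟨u, k, hu, rfl⟩ := hv
  rcases eq_or_ne k 0 with rfl | hk
  · rw [mul_zero, wMap_zero]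
    cases hu with
    | base => exact AlternatingReach.flip.mem_wordOrbit
    | flip => rw [xMap_xMap]; exact AlternatingReach.base.mem_wordOrbit
    | @step u k hu hk => rw [xMap_xMap]; exact ⟨u, k, hu, rfl⟩
  · exact (hu.step hk).mem_wordOrbit

theorem wMap_mem_wordOrbit {lam : ℤ} {p v : ℤ × ℤ × ℤ} (l : ℤ) (hv : v ∈ wordOrbit lam p) :
    wMap (lam * l) v ∈ wordOrbit lam p := by
  obtain ⟨u, k, hu, rfl⟩ := hv
  exact ⟨u, l + k, hu, by rw [wMap_wMap, mul_add]⟩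

theorem coe_mem_wordOrbit {n lam : ℤ} {p : ℤ × ℤ × ℤ} {g : Equiv.Perm (AT n)}
    (hg : g ∈ Hgrp n lam) (v : AT n) :
    (g v).1 ∈ wordOrbit lam p ↔ v.1 ∈ wordOrbit lam p := by
  induction hg using Subgroup.closure_induction generalizing v with
  | mem g hg =>
    rcases hg with rfl | rfl
    · rw [coe_xPerm]
      refine ⟨fun h => ?_, xMap_mem_wordOrbit⟩
      simpa only [xMap_xMap] using xMap_mem_wordOrbit h
    · rw [coe_wPerm]
      refine ⟨fun h => ?_, fun h => ?_⟩
      · simpa [wMap_wMap, wMap_zero] using wMap_mem_wordOrbit (-1) h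
      · simpa using wMap_mem_wordOrbit 1 h
  | one => rfl
  | mul g h _ _ ihg ihh => exact (ihg (h v)).trans (ihh v)
  | inv g _ ih => simpa using (ih (g⁻¹ v)).symm

/-- A cone of triples, with first coordinate of absolute value at least `r`, that is preserved by
`xMap ∘ wMap m` for `3 ≤ |m|`. -/
structure InCone (r : ℤ) (p : ℤ × ℤ × ℤ) : Prop where
  le_abs : r ≤ |p.1|
  abs_le : 3 * |p.1| ≤ 4 * p.2.2
  abs_le_add : 5 * |p.1| ≤ p.2.1 + 6 * p.2.2

theorem step_bounds {a b c m : ℤ} (hm : 3 ≤ m) (h : 3 * |a| ≤ 4 * c)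
    (h' : 5 * |a| ≤ b + 6 * c) :
    |a| ≤ a + m * c ∧ a + m * c ≤ 2 * m * a + b + m ^ 2 * c := by
  have hc : 0 ≤ c := by linarith [abs_nonneg a]
  have hmc : 0 ≤ (m - 3) * c := mul_nonneg (by linarith) hc
  have hma : 0 ≤ (m - 3) * (4 * c - 3 * |a|) := mul_nonneg (by linarith) (by linarith)
  have hmm : 0 ≤ (m - 3) * ((m - 3) * c) := mul_nonneg (by linarith) hmc
  have hneg : 0 ≤ (2 * m - 1) * (a + |a|) :=
    mul_nonneg (by linarith) (by linarith [neg_abs_le a])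
  constructor
  · linarith [neg_abs_le a]
  · nlinarith

theorem InCone.xMap_wMap {r m : ℤ} {p : ℤ × ℤ × ℤ} (hp : InCone r p) (hm : 3 ≤ |m|) :
    InCone r (xMap (wMap m p)) := by
  obtain ⟨a, b, c⟩ := p
  obtain ⟨h1, h3, h4⟩ := hp
  dsimp only at h1 h3 h4
  have hc : 0 ≤ c := by linarith [abs_nonneg a]
  suffices H : |a| ≤ |a + m * c| ∧ |a + m * c| ≤ 2 * m * a + b + m ^ 2 * c by
    have := abs_nonneg (a + m * c)
    constructor <;> simp only [xMap, wMap, abs_neg] <;> linarith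
  rcases le_total 0 m with h0 | h0
  · rw [abs_of_nonneg h0] at hm
    obtain ⟨h, h'⟩ := step_bounds hm h3 h4
    rw [abs_of_nonneg ((abs_nonneg a).trans h)]
    exact ⟨h, h'⟩
  · rw [abs_of_nonpos h0] at hm
    rw [← abs_neg a] at h3 h4
    obtain ⟨h, h'⟩ := step_bounds hm h3 h4
    rw [← abs_neg (a + m * c), show -(a + m * c) = -a + -m * c by ring,
      abs_of_nonneg ((abs_nonneg _).trans h), ← abs_neg a]
    exact ⟨h, by linarith⟩

theorem three_le_abs_mul {lam k : ℤ} (hlam : 3 ≤ lam) (hk : k ≠ 0) : 3 ≤ |lam * k| := by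
  rw [abs_mul, abs_of_nonneg (by linarith)]
  nlinarith [Int.one_le_abs hk]

theorem AlternatingReach.inCone {lam r : ℤ} {p u : ℤ × ℤ × ℤ} (hlam : 3 ≤ lam)
    (hp : InCone r p) (hxp : InCone r (xMap p)) (hu : AlternatingReach lam p u) :
    InCone r u := by
  induction hu with
  | base => exact hp
  | flip => exact hxp
  | step _ hk ih => exact ih.xMap_wMap (three_le_abs_mul hlam hk)

theorem le_abs_of_mem_wordOrbit {lam r : ℤ} {p v : ℤ × ℤ × ℤ} (hlam : 3 ≤ lam)
    (hp : InCone r p) (hxp : InCone r (xMap p)) (hv : v ∈ wordOrbit lam p) : r ≤ |v.1| := by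
  obtain ⟨u, k, hu, rfl⟩ := hv
  rcases eq_or_ne k 0 with rfl | hk
  · rw [mul_zero, wMap_zero]
    exact (hu.inCone hlam hp hxp).le_abs
  · simpa only [xMap, abs_neg] using ((hu.step hk).inCone hlam hp hxp).le_abs

theorem lt_eps : (3 / 4 : ℝ) < eps := by
  have : √7 < 2.75 := by rw [Real.sqrt_lt' (by norm_num)]; norm_num
  unfold eps
  linarith

theorem five_lt_seven_mul_eps : (5 : ℝ) < 7 * eps := by
  have : √7 < 20 / 7 := by rw [Real.sqrt_lt' (by norm_num)]; norm_num
  unfold eps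
  linarith


theorem stmt9 (n lam : ℤ) (hlam : 3 ≤ lam) (α : AT n)
    (ha : 0 < α.1.1) (hn : 0 < α.1.1 ^ 2 - n)
    (hb : (α.1.2.1 : ℝ) > eps * (α.1.1 : ℝ))
    (hc : (α.1.2.2 : ℝ) > eps * (α.1.1 : ℝ)) :
    ∀ g : Equiv.Perm (AT n), g ∈ Hgrp n lam → |(g α).1.1| ≥ α.1.1 := by
  intro g hg
  obtain ⟨⟨a, b, c⟩, h⟩ := α
  dsimp only at ha hn hb hc
  have ha' : (0 : ℝ) < a := by exact_mod_cast ha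
  have h1 := mul_lt_mul_of_pos_right lt_eps ha'
  have h2 := mul_lt_mul_of_pos_right five_lt_seven_mul_eps ha'
  have hb3 : 3 * a < 4 * b := by
    have : (3 : ℝ) * a < 4 * b := by linarith
    exact_mod_cast this
  have hc3 : 3 * a < 4 * c := by
    have : (3 : ℝ) * a < 4 * c := by linarith
    exact_mod_cast this
  have hbc : 5 * a < b + 6 * c := by
    have : (5 : ℝ) * a < b + 6 * c := by linarith
    exact_mod_cast this
  have hcb : 5 * a < c + 6 * b := by
    have : (5 : ℝ) * a < c + 6 * b := by linarith
    exact_mod_cast this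
  have habs : |a| = a := abs_of_pos ha
  have hp : InCone a (a, b, c) := by constructor <;> dsimp only <;> linarith
  have hxp : InCone a (xMap (a, b, c)) := by
    constructor <;> simp only [xMap, abs_neg] <;> linarith
  exact le_abs_of_mem_wordOrbit hlam hp hxp
    ((coe_mem_wordOrbit hg _).2 AlternatingReach.base.mem_wordOrbit)
end
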